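/- Let n ≥ 2. The group generated by shears is dense in the group of holomorphic automorphisms of ℂⁿ: for every holomorphic automorphism Φ of ℂⁿ, every compact set K ⊆ ℂⁿ, and every ε > 0, there exists a finite composition ψ of shears of ℂⁿ such that ‖ψ(z) − Φ(z)‖ < ε for all z ∈ K. -/

import Mathlib

noncomputable section

/-- A "basic shear" of ℂⁿ: the map
`Φ(z₁,…,zₙ) = (z₁,…,z_{n−1}, e^{f(z₁,…,z_{n−1})} zₙ + g(z₁,…,z_{n−1}))`
for entire functions `f, g` of the first `n-1` variables. -/
def IsBasicShear {n : ℕ} (Φ : EuclideanSpace ℂ (Fin n) → EuclideanSpace ℂ (Fin n)) : Prop :=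
  ∃ (i : Fin n) (f g : EuclideanSpace ℂ (Fin n) → ℂ),
    (i : ℕ) = n - 1 ∧
    Differentiable ℂ f ∧ Differentiable ℂ g ∧
    (∀ z w : EuclideanSpace ℂ (Fin n), (∀ j : Fin n, j ≠ i → z j = w j) → f z = f w) ∧
    (∀ z w : EuclideanSpace ℂ (Fin n), (∀ j : Fin n, j ≠ i → z j = w j) → g z = g w) ∧
    (∀ z : EuclideanSpace ℂ (Fin n), Φ z i = Complex.exp (f z) * z i + g z) ∧
    (∀ z : EuclideanSpace ℂ (Fin n), ∀ j : Fin n, j ≠ i → Φ z j = z j)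

/-- A shear of ℂⁿ: a `GLₙ(ℂ)`-conjugate `A⁻¹ ∘ Φ ∘ A` of a basic shear `Φ`. -/
def IsShear {n : ℕ} (ψ : EuclideanSpace ℂ (Fin n) → EuclideanSpace ℂ (Fin n)) : Prop :=
  ∃ (A : EuclideanSpace ℂ (Fin n) ≃L[ℂ] EuclideanSpace ℂ (Fin n))
    (Φ : EuclideanSpace ℂ (Fin n) → EuclideanSpace ℂ (Fin n)),
    IsBasicShear Φ ∧ ψ = fun z => A.symm (Φ (A z))

/-- A finite composition of shears of ℂⁿ. -/
def IsShearComposition {n : ℕ} (ψ : EuclideanSpace ℂ (Fin n) → EuclideanSpace ℂ (Fin n)) : Prop :=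
  ∃ L : List (EuclideanSpace ℂ (Fin n) → EuclideanSpace ℂ (Fin n)),
    L ≠ [] ∧ (∀ φ ∈ L, IsShear φ) ∧ ψ = L.foldr (· ∘ ·) id

/-- A holomorphic automorphism of ℂⁿ: a bijective entire map with entire inverse. -/
def IsHolomorphicAutomorphism {n : ℕ}
    (F : EuclideanSpace ℂ (Fin n) → EuclideanSpace ℂ (Fin n)) : Prop :=
  Differentiable ℂ F ∧ ∃ G : EuclideanSpace ℂ (Fin n) → EuclideanSpace ℂ (Fin n),
    Differentiable ℂ G ∧ (∀ z, G (F z) = z) ∧ (∀ z, F (G z) = z)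

/-- The complex Euclidean space `ℂⁿ`. -/
abbrev CSpace (n : ℕ) := EuclideanSpace ℂ (Fin n)

section ShearMaps

variable {n : ℕ}

lemma isShear_add_smul (hn : 2 ≤ n) {v : CSpace n} (η : CSpace n →L[ℂ] ℂ) (hη : η v = 1)
    {f g : CSpace n → ℂ} (hf : Differentiable ℂ f) (hg : Differentiable ℂ g)
    (hfv : ∀ x (s : ℂ), f (x + s • v) = f x) (hgv : ∀ x (s : ℂ), g (x + s • v) = g x) :
    IsShear (fun x : CSpace n => x + ((Complex.exp (f x) - 1) * η x + g x) • v) := by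
  have hv : v ≠ 0 := by rintro rfl; simp at hη
  let i : Fin n := ⟨n - 1, by omega⟩
  obtain ⟨A, hA⟩ := SeparatingDual.exists_continuousLinearEquiv_apply_eq (R := ℂ) hv
    (show (EuclideanSpace.single i (1 : ℂ) : CSpace n) ≠ 0 by simp)
  have hA' : A.symm (EuclideanSpace.single i (1 : ℂ)) = v := by rw [← hA, A.symm_apply_apply]
  have key : ∀ z w : CSpace n, (∀ j : Fin n, j ≠ i → z j = w j) →
      A.symm z = A.symm w + (z i - w i) • v := by
    intro z w h
    rw [← hA', ← map_smul, ← map_add]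
    congr 1
    ext j
    by_cases hj : j = i
    · subst hj; simp
    · simp [hj, h j hj]
  have hproj : Differentiable ℂ (fun y : CSpace n => y i) :=
    (EuclideanSpace.proj i : CSpace n →L[ℂ] ℂ).differentiable
  have hAs : Differentiable ℂ (fun y : CSpace n => A.symm y) := A.symm.differentiable
  have hfA := hf.comp hAs
  have hgA := hg.comp hAs
  have hηA := η.differentiable.comp hAs
  refine ⟨A, fun y => y + ((Complex.exp (f (A.symm y)) - 1) * η (A.symm y) + g (A.symm y)) •
    EuclideanSpace.single i (1 : ℂ), ⟨i, fun y => f (A.symm y),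
      fun y => g (A.symm y) + (Complex.exp (f (A.symm y)) - 1) * (η (A.symm y) - y i),
      rfl, hfA, hgA.add ((hfA.cexp.sub_const 1).mul (hηA.sub hproj)), ?_, ?_, ?_, ?_⟩, ?_⟩
  · intro z w h
    simp only [key z w h, hfv]
  · intro z w h
    simp only [key z w h, hfv, hgv, map_add, map_smul, hη, smul_eq_mul]
    ring
  · intro z
    simp
    ring
  · intro z j hj
    simp [hj]
  · funext x
    simp [hA']

lemma IsShear.isShearComposition {ψ : CSpace n → CSpace n} (h : IsShear ψ) :
    IsShearComposition ψ :=
  ⟨[ψ], by simp, by simpa using h, by simp⟩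

lemma IsShearComposition.comp {ψ φ : CSpace n → CSpace n} (hψ : IsShearComposition ψ)
    (hφ : IsShearComposition φ) : IsShearComposition (ψ ∘ φ) := by
  obtain ⟨L, hL, hLs, rfl⟩ := hψ
  obtain ⟨M, hM, hMs, rfl⟩ := hφ
  refine ⟨L ++ M, by simp [hL], ?_, ?_⟩
  · intro θ hθ
    rcases List.mem_append.1 hθ with h | h
    exacts [hLs θ h, hMs θ h]
  · clear hL hLs hMs
    induction L with
    | nil => simp
    | cons a L ih => simp only [List.foldr_cons, List.cons_append, ← ih, Function.comp_assoc]

lemma exists_apply_eq_one {v : CSpace n} (hv : v ≠ 0) : ∃ η : CSpace n →L[ℂ] ℂ, η v = 1 :=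
  SeparatingDual.exists_eq_one hv

lemma isShearComposition_add_smul (hn : 2 ≤ n) {v : CSpace n} {g : CSpace n → ℂ}
    (hg : Differentiable ℂ g) (hgv : ∀ x (s : ℂ), g (x + s • v) = g x) :
    IsShearComposition (fun x : CSpace n => x + g x • v) := by
  by_cases hv : v = 0
  · have h1 : (EuclideanSpace.single ⟨0, by omega⟩ (1 : ℂ) : CSpace n) ≠ 0 := by simp
    obtain ⟨η, hη⟩ := exists_apply_eq_one h1
    have := isShear_add_smul hn η hη (f := fun _ => 0) (g := fun _ => 0) (by fun_prop)
      (by fun_prop) (by simp) (by simp)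
    simpa [hv] using this.isShearComposition
  · obtain ⟨η, hη⟩ := exists_apply_eq_one hv
    have := isShear_add_smul hn η hη (f := fun _ => 0) (by fun_prop) hg (by simp) hgv
    simpa using this.isShearComposition

lemma isShearComposition_add_mul_smul (hn : 2 ≤ n) {v : CSpace n} (η : CSpace n →L[ℂ] ℂ)
    (hη : η v = 1) {f : CSpace n → ℂ} (hf : Differentiable ℂ f)
    (hfv : ∀ x (s : ℂ), f (x + s • v) = f x) :
    IsShearComposition (fun x : CSpace n => x + ((Complex.exp (f x) - 1) * η x) • v) := by
  have := isShear_add_smul hn η hη hf (g := fun _ => 0) (by fun_prop) hfv (by simp)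
  simpa using this.isShearComposition

lemma isShearComposition_id (hn : 2 ≤ n) :
    IsShearComposition (id : CSpace n → CSpace n) := by
  simpa [Function.id_def] using
    isShearComposition_add_smul hn (v := 0) (g := fun _ => 0) (by fun_prop) (by simp)

lemma isShearComposition_add_const (hn : 2 ≤ n) (b : CSpace n) :
    IsShearComposition (fun x : CSpace n => x + b) := by
  simpa using
    isShearComposition_add_smul hn (v := b) (g := fun _ => 1) (by fun_prop) (by simp)

lemma IsShearComposition.iterate (hn : 2 ≤ n) {ψ : CSpace n → CSpace n}
    (hψ : IsShearComposition ψ) (N : ℕ) : IsShearComposition ψ^[N] := by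
  induction N with
  | zero => simpa using isShearComposition_id hn
  | succ N ih => exact ih.comp hψ

lemma isShearComposition_diagonal (hn : 2 ≤ n) (d : Fin n → ℂ) (hd : ∀ i, d i ≠ 0)
    (s : Finset (Fin n)) :
    IsShearComposition (fun x : CSpace n =>
      (WithLp.toLp 2 fun i => if i ∈ s then d i * x i else x i : CSpace n)) := by
  induction s using Finset.induction_on with
  | empty => simpa [Function.id_def] using isShearComposition_id hn
  | insert i s hi ih =>
    have := isShearComposition_add_mul_smul hn (v := EuclideanSpace.single i (1 : ℂ))
      (EuclideanSpace.proj i) (by simp) (f := fun _ => Complex.log (d i)) (by fun_prop) (by simp)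
    convert this.comp ih using 1
    funext x
    ext j
    by_cases hj : j = i
    · subst hj
      simp [hi, Complex.exp_log (hd j)]
      ring
    · simp [hj, hi]

lemma isShearComposition_linear (hn : 2 ≤ n) (A : CSpace n ≃ₗ[ℂ] CSpace n) :
    IsShearComposition (fun x => A x) := by
  let b := (EuclideanSpace.basisFun (Fin n) ℂ).toBasis
  have hb : ∀ (M : Matrix (Fin n) (Fin n) ℂ) (x : CSpace n) (j : Fin n),
      Matrix.toLin b b M x j = ∑ k, M j k * x k := by
    intro M x j
    simp [b, Matrix.toLin_apply, Matrix.mulVec, dotProduct, Pi.single_apply]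
  have main : ∀ M : Matrix (Fin n) (Fin n) ℂ, M.det ≠ 0 →
      IsShearComposition (fun x => Matrix.toLin b b M x) := by
    intro M hM
    refine Matrix.diagonal_transvection_induction_of_det_ne_zero
      (fun M => IsShearComposition (fun x => Matrix.toLin b b M x)) M hM ?_ ?_ ?_
    · intro D hD
      have hD' : ∀ i, D i ≠ 0 := by
        simpa [Matrix.det_diagonal, Finset.prod_ne_zero_iff] using hD
      convert isShearComposition_diagonal hn D hD' Finset.univ using 1
      funext x
      ext j
      simp [hb, Matrix.diagonal_apply]
    · intro t
      have := isShearComposition_add_smul hn (v := EuclideanSpace.single t.i (1 : ℂ))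
        (g := fun x => t.c * x t.j)
        ((EuclideanSpace.proj t.j : CSpace n →L[ℂ] ℂ).differentiable.const_mul _)
        (by simp [t.hij.symm])
      convert this using 1
      funext x
      ext j
      rw [hb]
      by_cases hj : j = t.i
      · subst hj
        simp [Matrix.TransvectionStruct.toMatrix, Matrix.transvection, Matrix.one_apply,
          Matrix.single_apply, add_mul, Finset.sum_add_distrib]
      · simp [Matrix.TransvectionStruct.toMatrix, Matrix.transvection, Matrix.one_apply, hj,
          Ne.symm hj]
    · intro P Q _ _ ihP ihQ
      convert ihP.comp ihQ using 1
      funext x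
      simp [Matrix.toLin_mul b b b]
  have := main (LinearMap.toMatrix b b A) (by
    rw [LinearMap.det_toMatrix]
    exact (LinearEquiv.isUnit_det' A).ne_zero)
  simpa using this

end ShearMaps

section ShearFields

open Filter Topology

variable {n : ℕ}

/-- A vector field `W` is tangent to the group generated by shears if, for small times `h > 0`,
the Euler step `x ↦ x + h W(x)` is approximated on compact sets, up to an error which is small
compared to `h`, by compositions of shears. -/
def IsShearTangent (W : CSpace n → CSpace n) : Prop :=
  ∀ K : Set (CSpace n), IsCompact K → ∀ δ : ℝ, 0 < δ → ∀ᶠ h : ℝ in 𝓝[>] 0,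
    ∃ S, IsShearComposition S ∧ ∀ x ∈ K, ‖S x - (x + (h : ℂ) • W x)‖ ≤ δ * h

/-- A continuous vector field all of whose complex multiples are tangent to the group generated
by shears. -/
def IsShearField (W : CSpace n → CSpace n) : Prop :=
  Continuous W ∧ ∀ c : ℂ, IsShearTangent (c • W)

lemma norm_ofReal_smul_of_pos {h : ℝ} (hh : 0 < h) (v : CSpace n) : ‖(h : ℂ) • v‖ = h * ‖v‖ := by
  rw [norm_smul, Complex.norm_real, Real.norm_of_nonneg hh.le]

lemma IsShearTangent.of_approx {W : CSpace n → CSpace n}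
    (H : ∀ K : Set (CSpace n), IsCompact K → ∀ δ : ℝ, 0 < δ →
      ∃ U, IsShearTangent U ∧ ∀ x ∈ K, ‖U x - W x‖ ≤ δ) : IsShearTangent W := by
  intro K hK δ hδ
  obtain ⟨U, hU, hUW⟩ := H K hK (δ / 2) (by positivity)
  filter_upwards [hU K hK (δ / 2) (by positivity), self_mem_nhdsWithin] with h ⟨S, hS, hSU⟩ hh
  refine ⟨S, hS, fun x hx => ?_⟩
  have hh' : (0 : ℝ) < h := hh
  calc ‖S x - (x + (h : ℂ) • W x)‖
      = ‖(S x - (x + (h : ℂ) • U x)) + (h : ℂ) • (U x - W x)‖ := by congr 1; module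
    _ ≤ ‖S x - (x + (h : ℂ) • U x)‖ + h * ‖U x - W x‖ := by
        rw [← norm_ofReal_smul_of_pos hh']; exact norm_add_le _ _
    _ ≤ δ / 2 * h + h * (δ / 2) := by gcongr; exacts [hSU x hx, hUW x hx]
    _ = δ * h := by ring

lemma IsShearTangent.add {W U : CSpace n → CSpace n} (hW : IsShearTangent W)
    (hU : IsShearTangent U) (hWc : Continuous W) (hUc : Continuous U) :
    IsShearTangent (W + U) := by
  intro K hK δ hδ
  have hK' : IsCompact (Metric.cthickening 1 K) := hK.cthickening
  obtain ⟨ρ, hρ, hρU⟩ := Metric.uniformContinuousOn_iff.1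
    (hK'.uniformContinuousOn_of_continuous hUc.continuousOn) (δ / 3) (by positivity)
  obtain ⟨M, hM⟩ := hK.exists_bound_of_continuousOn hWc.continuousOn
  have hr : 0 < min ρ 1 / (|M| + δ + 1) := by positivity
  filter_upwards [hW K hK (δ / 3) (by positivity), hU _ hK' (δ / 3) (by positivity),
    Ioo_mem_nhdsGT hr] with h ⟨S, hS, hSW⟩ ⟨T, hT, hTU⟩ hh
  refine ⟨T ∘ S, hT.comp hS, fun x hx => ?_⟩
  have h0 : 0 < h := hh.1
  have hSx : ‖S x - x‖ < min ρ 1 := by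
    have h1 : ‖S x - x‖ ≤ ‖S x - (x + (h : ℂ) • W x)‖ + ‖(h : ℂ) • W x‖ := by
      refine le_trans (le_of_eq ?_) (norm_add_le _ _)
      congr 1; module
    have h2 := hSW x hx
    rw [norm_ofReal_smul_of_pos h0] at h1
    have h3 := hM x hx
    have h4 := hh.2
    rw [lt_div_iff₀ (by positivity)] at h4
    have h5 := le_abs_self M
    nlinarith
  have hxK : x ∈ Metric.cthickening 1 K := Metric.self_subset_cthickening K hx
  have hSK : S x ∈ Metric.cthickening 1 K :=
    Metric.mem_cthickening_of_dist_le _ x _ _ hx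
      (by rw [dist_eq_norm]; exact hSx.le.trans (min_le_right _ _))
  have hUx := hρU (S x) hSK x hxK (by rw [dist_eq_norm]; exact hSx.trans_le (min_le_left _ _))
  rw [dist_eq_norm] at hUx
  calc ‖T (S x) - (x + (h : ℂ) • (W x + U x))‖
      = ‖(T (S x) - (S x + (h : ℂ) • U (S x))) + (S x - (x + (h : ℂ) • W x))
          + (h : ℂ) • (U (S x) - U x)‖ := by congr 1; module
    _ ≤ ‖T (S x) - (S x + (h : ℂ) • U (S x))‖ + ‖S x - (x + (h : ℂ) • W x)‖
          + h * ‖U (S x) - U x‖ := by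
        rw [← norm_ofReal_smul_of_pos h0]; exact norm_add₃_le
    _ ≤ δ / 3 * h + δ / 3 * h + h * (δ / 3) := by
        gcongr
        exacts [hTU _ hSK, hSW x hx]
    _ = δ * h := by ring

lemma IsShearField.add {W U : CSpace n → CSpace n} (hW : IsShearField W) (hU : IsShearField U) :
    IsShearField (W + U) := by
  refine ⟨hW.1.add hU.1, fun c => ?_⟩
  rw [smul_add]
  exact (hW.2 c).add (hU.2 c) (hW.1.const_smul c) (hU.1.const_smul c)

lemma IsShearField.smul {W : CSpace n → CSpace n} (hW : IsShearField W) (c : ℂ) :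
    IsShearField (c • W) := by
  refine ⟨hW.1.const_smul c, fun d => ?_⟩
  rw [smul_smul]
  exact hW.2 _

lemma IsShearField.of_approx {W : CSpace n → CSpace n} (hWc : Continuous W)
    (H : ∀ K : Set (CSpace n), IsCompact K → ∀ δ : ℝ, 0 < δ →
      ∃ U, IsShearField U ∧ ∀ x ∈ K, ‖U x - W x‖ ≤ δ) : IsShearField W := by
  refine ⟨hWc, fun c => .of_approx fun K hK δ hδ => ?_⟩
  obtain ⟨U, hU, hUW⟩ := H K hK (δ / (‖c‖ + 1)) (by positivity)
  refine ⟨c • U, hU.2 c, fun x hx => ?_⟩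
  have h1 := hUW x hx
  rw [le_div_iff₀ (by positivity)] at h1
  rw [Pi.smul_apply, Pi.smul_apply, ← smul_sub, norm_smul]
  nlinarith [norm_nonneg (U x - W x)]

lemma isShearField_smul (hn : 2 ≤ n) {v : CSpace n} {g : CSpace n → ℂ} (hg : Differentiable ℂ g)
    (hgv : ∀ x (s : ℂ), g (x + s • v) = g x) : IsShearField (fun x => g x • v) := by
  refine ⟨hg.continuous.smul continuous_const, fun c K _ δ hδ => ?_⟩
  filter_upwards [self_mem_nhdsWithin] with h (hh : 0 < h)
  refine ⟨_, isShearComposition_add_smul hn (v := v) (g := fun x => (h * c) * g x)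
    (hg.const_mul _) (by simp [hgv]), fun x _ => ?_⟩
  have : x + (↑h * c * g x) • v - (x + (h : ℂ) • (c • fun x => g x • v) x) = 0 := by
    simp only [Pi.smul_apply]; module
  rw [this, norm_zero]
  positivity

lemma isShearField_mul_smul (hn : 2 ≤ n) {v : CSpace n} (η : CSpace n →L[ℂ] ℂ) (hη : η v = 1)
    {g : CSpace n → ℂ} (hg : Differentiable ℂ g) (hgv : ∀ x (s : ℂ), g (x + s • v) = g x) :
    IsShearField (fun x => (g x * η x) • v) := by
  refine ⟨(hg.continuous.mul η.continuous).smul continuous_const, fun c K hK δ hδ => ?_⟩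
  obtain ⟨M, hM⟩ := hK.exists_bound_of_continuousOn (f := fun x => c * g x)
    (hg.continuous.const_smul c).continuousOn
  obtain ⟨M', hM'⟩ := hK.exists_bound_of_continuousOn (f := fun x => η x • v)
    (η.continuous.smul continuous_const).continuousOn
  have hr : 0 < min 1 δ / ((|M| + 1) ^ 2 * (|M'| + 1)) := by positivity
  filter_upwards [Ioo_mem_nhdsGT hr] with h hh
  refine ⟨_, isShearComposition_add_mul_smul hn η hη (f := fun x => h * (c * g x))
    ((hg.const_mul _).const_mul _) (by simp [hgv]), fun x hx => ?_⟩
  have h0 : 0 < h := hh.1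
  have h1 := hh.2
  rw [lt_div_iff₀ (by positivity)] at h1
  have hM1 : ‖c * g x‖ ≤ |M| + 1 := by linarith [hM x hx, le_abs_self M]
  have hM2 : ‖η x • v‖ ≤ |M'| + 1 := by linarith [hM' x hx, le_abs_self M']
  have hn1 : ‖(h : ℂ) * (c * g x)‖ ≤ h * (|M| + 1) := by
    rw [norm_mul, Complex.norm_real, Real.norm_of_nonneg h0.le]
    gcongr
  have hsmall : h * (|M| + 1) ≤ 1 := by
    refine le_trans ?_ (h1.le.trans (min_le_left _ _))
    have : 1 * 1 ≤ (|M| + 1) * (|M'| + 1) := by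
      gcongr <;> linarith [abs_nonneg M, abs_nonneg M']
    have h3 : 0 < h * (|M| + 1) := by positivity
    nlinarith
  have hexp := Complex.norm_exp_sub_one_sub_id_le (hn1.trans hsmall)
  calc _ = ‖(Complex.exp (h * (c * g x)) - 1 - h * (c * g x)) • (η x • v)‖ := by
        simp only [Pi.smul_apply]; congr 1; module
    _ ≤ (h * (|M| + 1)) ^ 2 * (|M'| + 1) := by
        rw [norm_smul]
        gcongr
        exact hexp.trans (by gcongr)
    _ = (h * ((|M| + 1) ^ 2 * (|M'| + 1))) * h := by ring
    _ ≤ δ * h := by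
        gcongr
        exact h1.le.trans (min_le_right _ _)

lemma isShearField_exp_smul (hn : 2 ≤ n) (μ : CSpace n →L[ℂ] ℂ) (v : CSpace n) :
    IsShearField (fun x => Complex.exp (μ x) • v) := by
  have base : ∀ (ν : CSpace n →L[ℂ] ℂ) (u : CSpace n), ν u = 0 →
      IsShearField (fun x => Complex.exp (ν x) • u) := fun ν u hu =>
    isShearField_smul hn ν.differentiable.cexp (by simp [hu])
  by_cases hμ : μ v = 0
  · exact base μ v hμ
  obtain ⟨w, hw, hw0⟩ : ∃ w ∈ LinearMap.ker μ.toLinearMap, w ≠ 0 :=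
    Submodule.exists_mem_ne_zero_of_ne_bot
      (LinearMap.ker_ne_bot_of_finrank_lt (by simp; omega))
  have hμw : μ w = 0 := hw
  obtain ⟨η', hη'⟩ := exists_apply_eq_one hw0
  obtain ⟨η, hηw, hηv⟩ : ∃ η : CSpace n →L[ℂ] ℂ, η w = 1 ∧ η v = 0 :=
    ⟨η' - (η' v / μ v) • μ, by simp [hη', hμw], by simp [hμ]⟩
  have hF : ∀ ε : ℂ, IsShearField
      (fun x => Complex.exp ((μ + ε • η) x) • (ε • v - μ v • w)) := fun ε =>
    base _ _ (by simp [hμw, hηw, hηv])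
  have hG : IsShearField (fun x => (Complex.exp (μ x) * η x) • w) :=
    isShearField_mul_smul hn η hηw μ.differentiable.cexp (by simp [hμw])
  refine .of_approx (by fun_prop) fun K hK δ hδ => ?_
  obtain ⟨M, hM⟩ := hK.exists_bound_of_continuousOn (f := η) η.continuous.continuousOn
  obtain ⟨M', hM'⟩ := hK.exists_bound_of_continuousOn (f := fun x => Complex.exp (μ x))
    (by fun_prop)
  set A := |M| + 1
  set B := |M'| + 1
  set C := 2 * ‖v‖ + ‖μ v • w‖ + 1
  have hA : 1 ≤ A := by simp [A]
  obtain ⟨ε, hε0, hε⟩ : ∃ ε : ℝ, 0 < ε ∧ ε ≤ min 1 δ / (A ^ 2 * B * C + A) :=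
    ⟨_, by positivity, le_rfl⟩
  rw [le_div_iff₀ (by positivity)] at hε
  have hε' : (ε : ℂ) ≠ 0 := by exact_mod_cast hε0.ne'
  refine ⟨_, (((hF ε).add ((hF 0).smul (-1))).smul (ε : ℂ)⁻¹).add (hG.smul (μ v)),
    fun x hx => ?_⟩
  have hAx : ‖(ε : ℂ) * η x‖ ≤ ε * A := by
    rw [norm_mul, Complex.norm_real, Real.norm_of_nonneg hε0.le]
    gcongr
    linarith [hM x hx, le_abs_self M]
  have hBx : ‖Complex.exp (μ x)‖ ≤ B := by linarith [hM' x hx, le_abs_self M']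
  have hsmall : ε * A ≤ 1 := by
    have : 0 ≤ ε * (A ^ 2 * B * C) := by positivity
    linarith [min_le_left 1 δ]
  have e1 := Complex.norm_exp_sub_one_le (hAx.trans hsmall)
  have e2 := Complex.norm_exp_sub_one_sub_id_le (hAx.trans hsmall)
  calc _ = ‖Complex.exp (μ x) • ((Complex.exp (ε * η x) - 1) • v
          - (ε : ℂ)⁻¹ • (Complex.exp (ε * η x) - 1 - ε * η x) • (μ v • w))‖ := by
        congr 1
        simp only [Pi.add_apply, Pi.smul_apply, _root_.add_apply,
          _root_.smul_apply, smul_eq_mul, Complex.exp_add, zero_mul,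
          Complex.exp_zero]
        match_scalars <;> field_simp <;> ring
    _ ≤ B * (2 * (ε * A) * ‖v‖ + ε⁻¹ * ((ε * A) ^ 2 * ‖μ v • w‖)) := by
        rw [norm_smul]
        gcongr
        refine (norm_sub_le _ _).trans ?_
        rw [norm_smul, norm_smul, norm_smul (Complex.exp _ - 1 - _), norm_inv, Complex.norm_real,
          Real.norm_of_nonneg hε0.le]
        gcongr
        · exact e1.trans (by gcongr)
        · exact e2.trans (by gcongr)
    _ = ε * (A * B * (2 * ‖v‖) + A ^ 2 * B * ‖μ v • w‖) := by field_simp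
    _ ≤ ε * (A ^ 2 * B * C + A) := by
        refine mul_le_mul_of_nonneg_left ?_ hε0.le
        have h1 : A * B * (2 * ‖v‖) ≤ A ^ 2 * B * (2 * ‖v‖) := by
          gcongr
          nlinarith
        have h2 : 0 ≤ A ^ 2 * B := by positivity
        nlinarith [show C = 2 * ‖v‖ + ‖μ v • w‖ + 1 from rfl]
    _ ≤ δ := hε.trans (min_le_right _ _)

end ShearFields

section ExponentialApproximation

open Filter Topology

variable {n : ℕ} (K : Set (CSpace n))

/-- The restriction to `K` of the exponential of a linear functional. -/
def expRestrict (μ : CSpace n →L[ℂ] ℂ) : C(K, ℂ) := ⟨fun x => Complex.exp (μ x), by fun_prop⟩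

variable [CompactSpace K]

/-- The closed subalgebra of `C(K, ℂ)` generated by the exponentials of linear functionals. -/
def expAlgebra : Subalgebra ℂ C(K, ℂ) :=
  (Algebra.adjoin ℂ (Set.range (expRestrict K))).topologicalClosure

lemma isClosed_expAlgebra : IsClosed (expAlgebra K : Set C(K, ℂ)) :=
  Subalgebra.isClosed_topologicalClosure _

lemma expRestrict_mem_expAlgebra (μ : CSpace n →L[ℂ] ℂ) : expRestrict K μ ∈ expAlgebra K :=
  Subalgebra.le_topologicalClosure _ (Algebra.subset_adjoin ⟨μ, rfl⟩)

lemma linear_mem_expAlgebra (μ : CSpace n →L[ℂ] ℂ) :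
    (⟨fun x => μ x, by fun_prop⟩ : C(K, ℂ)) ∈ expAlgebra K := by
  rw [← SetLike.mem_coe, ← (isClosed_expAlgebra K).closure_eq, Metric.mem_closure_iff]
  intro δ hδ
  obtain ⟨M, hM⟩ := (isCompact_iff_compactSpace.2 ‹CompactSpace K›).exists_bound_of_continuousOn
    (f := μ) μ.continuous.continuousOn
  set A := |M| + 1
  obtain ⟨ε, hε0, hε⟩ : ∃ ε : ℝ, 0 < ε ∧ ε ≤ min 1 (δ / 2) / (A ^ 2 + A) :=
    ⟨_, by positivity, le_rfl⟩
  rw [le_div_iff₀ (by positivity)] at hε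
  have hε' : (ε : ℂ) ≠ 0 := by exact_mod_cast hε0.ne'
  refine ⟨(ε : ℂ)⁻¹ • (expRestrict K ((ε : ℂ) • μ) - 1), ?_, ?_⟩
  · exact (expAlgebra K).smul_mem (sub_mem (expRestrict_mem_expAlgebra K _) (one_mem _)) _
  rw [ContinuousMap.dist_lt_iff hδ]
  intro x
  have hAx : ‖(ε : ℂ) * μ x‖ ≤ ε * A := by
    rw [norm_mul, Complex.norm_real, Real.norm_of_nonneg hε0.le]
    gcongr
    linarith [hM x x.2, le_abs_self M]
  have hsmall : ε * A ≤ 1 := by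
    have : 0 ≤ ε * A ^ 2 := by positivity
    linarith [min_le_left 1 (δ / 2)]
  have e2 := Complex.norm_exp_sub_one_sub_id_le (hAx.trans hsmall)
  rw [dist_comm, dist_eq_norm]
  calc _ = ‖(ε : ℂ)⁻¹ * (Complex.exp (ε * μ x) - 1 - ε * μ x)‖ := by
        congr 1
        simp [expRestrict]
        field_simp
    _ ≤ ε⁻¹ * (ε * A) ^ 2 := by
        rw [norm_mul, norm_inv, Complex.norm_real, Real.norm_of_nonneg hε0.le]
        gcongr
        exact e2.trans (by gcongr)
    _ = ε * A ^ 2 := by field_simp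
    _ < δ := by
        have : 0 ≤ ε * A := by positivity
        linarith [min_le_right 1 (δ / 2)]

lemma inv_sub_mem_expAlgebra {R : ℝ} (i : Fin n) (hR : ∀ x ∈ K, ‖x i‖ < R) {ζ : ℂ}
    (hζ : ‖ζ‖ = R) {u : C(K, ℂ)} (hu : ∀ x : K, u x = (ζ - (x : CSpace n) i)⁻¹) :
    u ∈ expAlgebra K := by
  rcases isEmpty_or_nonempty K with hK | ⟨⟨x₀⟩⟩
  · convert zero_mem (expAlgebra K)
    ext x
    exact isEmptyElim x
  have hR0 : 0 < R := (norm_nonneg _).trans_lt (hR x₀ x₀.2)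
  have hζ0 : ζ ≠ 0 := by rw [← norm_pos_iff, hζ]; exact hR0
  have : CompleteSpace (expAlgebra K) := (isClosed_expAlgebra K).completeSpace_coe
  let t : expAlgebra K := ⟨ζ⁻¹ • (⟨fun x => EuclideanSpace.proj (𝕜 := ℂ) i (x : CSpace n),
    by fun_prop⟩ : C(K, ℂ)), (expAlgebra K).smul_mem (linear_mem_expAlgebra K _) _⟩
  have ht : ‖t‖ < 1 := by
    change ‖(t : C(K, ℂ))‖ < 1
    rw [ContinuousMap.norm_lt_iff _ one_pos]
    intro x
    simp only [t, ContinuousMap.smul_apply, ContinuousMap.coe_mk, norm_smul, norm_inv, hζ]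
    rw [inv_mul_lt_one₀ hR0]
    exact hR x x.2
  let U := Units.oneSub t ht
  have hU : u = ζ⁻¹ • ((U⁻¹ : (expAlgebra K)ˣ) : expAlgebra K) := by
    ext x
    have h1 : (1 - t) * ((U⁻¹ : (expAlgebra K)ˣ) : expAlgebra K) = 1 := U.mul_inv
    have h2 : (1 - ζ⁻¹ * (x : CSpace n) i) *
        (((U⁻¹ : (expAlgebra K)ˣ) : expAlgebra K) : C(K, ℂ)) x = 1 :=
      congrArg (fun a : expAlgebra K => (a : C(K, ℂ)) x) h1
    have hne : ζ - (x : CSpace n) i ≠ 0 := by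
      intro h0
      have := hR x x.2
      rw [← sub_eq_zero.1 h0, hζ] at this
      exact lt_irrefl _ this
    rw [hu, ContinuousMap.smul_apply, smul_eq_mul]
    refine inv_eq_of_mul_eq_one_right ?_
    rw [← h2]
    field_simp
  rw [hU]
  exact (expAlgebra K).smul_mem (Subtype.property _) _

lemma mem_expAlgebra_of_dependsOn (s : Finset (Fin n)) :
    ∀ f : CSpace n → ℂ, Differentiable ℂ f →
      (∀ z w : CSpace n, (∀ i ∈ s, z i = w i) → f z = f w) →
      ∀ u : C(K, ℂ), (∀ x : K, u x = f x) → u ∈ expAlgebra K := by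
  induction s using Finset.induction_on with
  | empty =>
    intro f _ hs u hu
    convert (expAlgebra K).algebraMap_mem (f 0)
    ext x
    rw [hu, hs x 0 (by simp)]
    rfl
  | insert i s hi ih =>
    intro f hf hs u hu
    obtain ⟨M, hM⟩ := (isCompact_iff_compactSpace.2 ‹CompactSpace K›).exists_bound_of_continuousOn
      (f := fun x : CSpace n => x i) (by fun_prop)
    let R := |M| + 1
    have hR0 : 0 < R := by positivity
    have hR : ∀ x ∈ K, ‖x i‖ < R := fun x hx => by linarith [hM x hx, le_abs_self M]
    let upd : ℂ → CSpace n → CSpace n := fun ζ x => x + (ζ - x i) • EuclideanSpace.single i (1 : ℂ)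
    have hupd : Differentiable ℂ (fun p : ℂ × CSpace n => upd p.1 p.2) := by
      have : Differentiable ℂ (fun p : ℂ × CSpace n => p.2 i) :=
        (EuclideanSpace.proj i : CSpace n →L[ℂ] ℂ).differentiable.comp differentiable_snd
      exact differentiable_snd.add ((differentiable_fst.sub this).smul_const _)
    have hupd_same : ∀ ζ x, upd ζ x i = ζ := by intro ζ x; simp [upd]
    have hupd_ne : ∀ ζ x j, j ≠ i → upd ζ x j = x j := by intro ζ x j hj; simp [upd, hj]
    have hne : ∀ θ (x : K), circleMap 0 R θ - (x : CSpace n) i ≠ 0 := by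
      intro θ x h0
      have := hR x x.2
      rw [← sub_eq_zero.1 h0] at this
      simp [abs_of_pos hR0] at this
    let I₁ : C(ℝ × K, ℂ) := ⟨fun p => (circleMap 0 R p.1 - (p.2 : CSpace n) i)⁻¹, by
      refine Continuous.inv₀ (by fun_prop) fun p => hne p.1 p.2⟩
    let I₂ : C(ℝ × K, ℂ) := ⟨fun p => f (upd (circleMap 0 R p.1) p.2), by
      have := hf.continuous
      have := hupd.continuous
      fun_prop⟩
    have hI : ∀ θ, I₁.curry θ * I₂.curry θ ∈ expAlgebra K := by
      intro θ
      refine mul_mem (inv_sub_mem_expAlgebra K i hR (ζ := circleMap 0 R θ)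
        (by simp [abs_of_pos hR0]) fun x => rfl) ?_
      refine ih (fun x => f (upd (circleMap 0 R θ) x)) ?_ ?_ _ fun x => rfl
      · exact hf.comp (hupd.comp ((differentiable_const _).prodMk differentiable_id))
      · intro z w h
        refine hs _ _ fun j hj => ?_
        by_cases hji : j = i
        · subst hji; rw [hupd_same, hupd_same]
        · rw [hupd_ne _ _ _ hji, hupd_ne _ _ _ hji, h j (Finset.mem_of_mem_insert_of_ne hj hji)]
    have : CompleteSpace (expAlgebra K) := (isClosed_expAlgebra K).completeSpace_coe
    let F : ℝ → expAlgebra K := fun θ => deriv (circleMap 0 R) θ • ⟨_, hI θ⟩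
    have hF : Continuous F := by
      have hd : Continuous (deriv (circleMap 0 R)) := by
        simp only [funext (deriv_circleMap 0 R)]
        fun_prop
      have hc : Continuous (fun θ => I₁.curry θ * I₂.curry θ) :=
        (map_continuous I₁.curry).mul (map_continuous I₂.curry)
      exact hd.smul (hc.subtype_mk hI)
    let J : expAlgebra K := (2 * Real.pi * Complex.I : ℂ)⁻¹ • ∫ θ in (0 : ℝ)..2 * Real.pi, F θ
    have hJ : u = J := by
      ext x
      let ev : expAlgebra K →L[ℂ] ℂ :=
        (ContinuousMap.evalCLM ℂ x).comp (Subalgebra.toSubmodule (expAlgebra K)).subtypeL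
      have h1 : (J : C(K, ℂ)) x = ev J := rfl
      rw [h1, map_smul, ← ContinuousLinearMap.intervalIntegral_comp_comm _
        (hF.intervalIntegrable _ _), hu]
      have hg : Differentiable ℂ (fun ζ => f (upd ζ x)) :=
        hf.comp (hupd.comp (differentiable_id.prodMk (differentiable_const _)))
      have := hg.diffContOnCl.two_pi_i_inv_smul_circleIntegral_sub_inv_smul (c := 0) (R := R)
        (w := (x : CSpace n) i) (by simpa using hR x x.2)
      have hx : upd ((x : CSpace n) i) x = x := by simp [upd]
      rw [hx] at this
      exact this.symm
    rw [hJ]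
    exact J.2

/-- Every entire function is, uniformly on compact sets, a limit of linear combinations of
exponentials of linear functionals. -/
lemma exists_mem_span_exp_approx {f : CSpace n → ℂ} (hf : Differentiable ℂ f)
    {K : Set (CSpace n)} (hK : IsCompact K) {δ : ℝ} (hδ : 0 < δ) :
    ∃ g ∈ Submodule.span ℂ (Set.range fun (μ : CSpace n →L[ℂ] ℂ) (x : CSpace n) =>
      Complex.exp (μ x)), ∀ x ∈ K, ‖g x - f x‖ ≤ δ := by
  have : CompactSpace K := isCompact_iff_compactSpace.1 hK
  have hfc := hf.continuous
  let u : C(K, ℂ) := ⟨fun x => f x, by fun_prop⟩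
  have hu : u ∈ expAlgebra K := mem_expAlgebra_of_dependsOn K Finset.univ f hf
    (fun z w h => by rw [show z = w from PiLp.ext fun i => h i (Finset.mem_univ i)]) u fun _ => rfl
  obtain ⟨v, hv, hvu⟩ := Metric.mem_closure_iff.1 hu δ hδ
  have hv' : v ∈ Submodule.span ℂ (Set.range (expRestrict K)) := by
    have hv₁ : v ∈ Subalgebra.toSubmodule (Algebra.adjoin ℂ (Set.range (expRestrict K))) := hv
    rw [Algebra.adjoin_eq_span_of_subset] at hv₁
    · exact hv₁
    intro w hw
    refine Submodule.subset_span ?_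
    induction hw using Submonoid.closure_induction with
    | mem w hw => exact hw
    | one => exact ⟨0, by ext; simp [expRestrict]⟩
    | mul w w' _ _ ih ih' =>
      obtain ⟨μ, rfl⟩ := ih
      obtain ⟨ν, rfl⟩ := ih'
      exact ⟨μ + ν, by ext; simp [expRestrict, Complex.exp_add]⟩
  obtain ⟨g, hg, hgv⟩ : ∃ g ∈ Submodule.span ℂ (Set.range fun (μ : CSpace n →L[ℂ] ℂ)
      (x : CSpace n) => Complex.exp (μ x)), ∀ x : K, g x = v x := by
    clear hvu hv
    induction hv' using Submodule.span_induction with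
    | mem w hw =>
      obtain ⟨μ, rfl⟩ := hw
      exact ⟨_, Submodule.subset_span ⟨μ, rfl⟩, fun _ => rfl⟩
    | zero => exact ⟨0, zero_mem _, fun _ => rfl⟩
    | add w w' _ _ ih ih' =>
      obtain ⟨g, hg, h⟩ := ih
      obtain ⟨g', hg', h'⟩ := ih'
      exact ⟨g + g', add_mem hg hg', fun x => by simp [h, h']⟩
    | smul c w _ ih =>
      obtain ⟨g, hg, h⟩ := ih
      exact ⟨c • g, Submodule.smul_mem _ c hg, fun x => by simp [h]⟩
  refine ⟨g, hg, fun x hx => ?_⟩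
  rw [hgv ⟨x, hx⟩, ← dist_eq_norm, dist_comm]
  exact (ContinuousMap.dist_apply_le_dist (f := u) (g := v) ⟨x, hx⟩).trans hvu.le

/-- Every entire vector field is tangent to the group generated by shears. -/
lemma isShearField_of_differentiable (hn : 2 ≤ n) {W : CSpace n → CSpace n}
    (hW : Differentiable ℂ W) : IsShearField W := by
  have zero : IsShearField (0 : CSpace n → CSpace n) := by
    simpa [Pi.zero_def] using isShearField_exp_smul hn 0 0
  have scalar : ∀ (f : CSpace n → ℂ) (v : CSpace n), Differentiable ℂ f →
      IsShearField (fun x => f x • v) := by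
    intro f v hf
    refine .of_approx (hf.continuous.smul continuous_const) fun K hK δ hδ => ?_
    obtain ⟨g, hg, hgf⟩ := exists_mem_span_exp_approx hf hK (δ := δ / (‖v‖ + 1)) (by positivity)
    refine ⟨fun x => g x • v, ?_, fun x hx => ?_⟩
    · clear hgf
      induction hg using Submodule.span_induction with
      | mem w hw =>
        obtain ⟨μ, rfl⟩ := hw
        exact isShearField_exp_smul hn μ v
      | zero => simpa [Pi.zero_def] using zero
      | add w w' _ _ ih ih' => simpa [add_smul, Pi.add_def] using ih.add ih'
      | smul c w _ ih => simpa [mul_smul, Pi.smul_def] using ih.smul c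
    · have h := hgf x hx
      rw [le_div_iff₀ (by positivity)] at h
      rw [← sub_smul, norm_smul]
      nlinarith [norm_nonneg (g x - f x)]
  have hsum : ∀ s : Finset (Fin n),
      IsShearField (∑ i ∈ s, fun x => W x i • EuclideanSpace.single i (1 : ℂ)) := by
    intro s
    induction s using Finset.induction_on with
    | empty => simpa using zero
    | insert i s hi ih =>
      rw [Finset.sum_insert hi]
      exact (scalar _ _
        ((EuclideanSpace.proj i : CSpace n →L[ℂ] ℂ).differentiable.comp hW)).add ih
  convert hsum Finset.univ using 1
  ext x j
  simp [Pi.single_apply]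

end ExponentialApproximation

section Flows

open Filter Topology

variable {n : ℕ}

/-- Entire maps are Lipschitz near every compact set. -/
lemma exists_lipschitz_near {G : CSpace n → CSpace n} (hG : Differentiable ℂ G)
    {K : Set (CSpace n)} (hK : IsCompact K) :
    ∃ L : ℝ, 0 ≤ L ∧ ∀ x ∈ K, ∀ y, ‖y - x‖ < 1 → ‖G y - G x‖ ≤ L * ‖y - x‖ := by
  obtain ⟨M, hM⟩ := (hK.cthickening (r := 1)).exists_bound_of_continuousOn
    hG.continuous.continuousOn
  refine ⟨2 * |M|, by positivity, fun x hx y hy => ?_⟩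
  have hb : ∀ z ∈ Metric.ball x 1, ‖G z‖ ≤ |M| := fun z hz =>
    (hM z (Metric.mem_cthickening_of_dist_le _ x _ _ hx (Metric.mem_ball.1 hz).le)).trans
      (le_abs_self M)
  have := Complex.dist_le_div_mul_dist_of_mapsTo_ball (f := G) (c := x) (z := y) (R₁ := 1)
    (R₂ := 2 * |M|) hG.differentiableOn (fun z hz => ?_) (by rwa [mem_ball_iff_norm])
  · simpa [dist_eq_norm] using this
  · rw [mem_closedBall_iff_norm]
    refine (norm_sub_le _ _).trans ?_
    linarith [hb z hz, hb x (Metric.mem_ball_self one_pos)]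

lemma norm_sub_sub_deriv_le {g : ℂ → CSpace n} (hg : Differentiable ℂ g) {M : ℝ}
    (hM : ∀ ζ ∈ Metric.ball (0 : ℂ) 1, ‖g ζ‖ ≤ M) {ζ : ℂ} (hζ : ‖ζ‖ < 1) :
    ‖g ζ - g 0 - ζ • deriv g 0‖ ≤ 4 * M * ‖ζ‖ ^ 2 := by
  have h0 : (0 : ℂ) ∈ Metric.ball (0 : ℂ) 1 := Metric.mem_ball_self one_pos
  have hζ' : ζ ∈ Metric.ball (0 : ℂ) 1 := by simpa using hζ
  have hslope : ∀ z ∈ Metric.ball (0 : ℂ) 1, ‖dslope g 0 z‖ ≤ 2 * M := by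
    intro z hz
    have := Complex.norm_dslope_le_div_of_mapsTo_ball (f := g) (c := 0) (z := z) (R₁ := 1)
      (R₂ := 2 * M) hg.differentiableOn (fun w hw => ?_) hz
    · simpa using this
    · rw [mem_closedBall_iff_norm]
      refine (norm_sub_le _ _).trans ?_
      linarith [hM w hw, hM 0 h0]
  have := Complex.dist_le_div_mul_dist_of_mapsTo_ball (f := dslope g 0) (c := 0) (z := ζ)
    (R₁ := 1) (R₂ := 4 * M)
    ((Complex.differentiableOn_dslope (Metric.ball_mem_nhds _ one_pos)).2 hg.differentiableOn)
    (fun w hw => ?_) hζ'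
  · rw [dslope_same, dist_eq_norm, dist_zero_right, div_one] at this
    have e : g ζ - g 0 - ζ • deriv g 0 = ζ • (dslope g 0 ζ - deriv g 0) := by
      rw [smul_sub, ← sub_smul_dslope g 0 ζ, sub_zero]
    rw [e, norm_smul]
    nlinarith [norm_nonneg ζ]
  · rw [mem_closedBall_iff_norm]
    refine (norm_sub_le _ _).trans ?_
    linarith [hslope w hw, hslope 0 h0]

variable {Φ G : CSpace n → CSpace n}

/-- The generator of the flow `(t, x) ↦ Φ (eᵗ Φ⁻¹(x))`, where `G = Φ⁻¹`. -/
def conjDilationField (Φ G : CSpace n → CSpace n) (x : CSpace n) : CSpace n :=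
  deriv (fun ζ : ℂ => Φ (Complex.exp ζ • G x)) 0

lemma exists_conjDilation_taylor_bound (hΦ : Differentiable ℂ Φ) (hG : Differentiable ℂ G)
    (hΦG : ∀ x, Φ (G x) = x) {K : Set (CSpace n)} (hK : IsCompact K) :
    ∃ C : ℝ, 0 ≤ C ∧ ∀ x ∈ K, ∀ h : ℝ, 0 < h → h < 1 →
      ‖Φ (Complex.exp h • G x) - (x + (h : ℂ) • conjDilationField Φ G x)‖ ≤ C * h ^ 2 := by
  have hΦc := hΦ.continuous
  have hGc := hG.continuous
  obtain ⟨M, hM⟩ := ((isCompact_closedBall (0 : ℂ) 1).prod hK).exists_bound_of_continuousOn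
    (f := fun p : ℂ × CSpace n => Φ (Complex.exp p.1 • G p.2)) (by fun_prop)
  refine ⟨4 * |M|, by positivity, fun x hx h h0 h1 => ?_⟩
  have hh : ‖(h : ℂ)‖ = h := by rw [Complex.norm_real, Real.norm_of_nonneg h0.le]
  have := norm_sub_sub_deriv_le (g := fun ζ : ℂ => Φ (Complex.exp ζ • G x)) (M := |M|)
    (hΦ.comp (Complex.differentiable_exp.smul_const _))
    (fun ζ hζ => (hM (ζ, x) ⟨Metric.ball_subset_closedBall hζ, hx⟩).trans (le_abs_self M))
    (ζ := h) (by rwa [hh])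
  simp only [Complex.exp_zero, one_smul, hΦG, hh] at this
  rwa [sub_sub] at this

lemma isShearTangent_conjDilationField (hn : 2 ≤ n) (hΦ : Differentiable ℂ Φ)
    (hG : Differentiable ℂ G) (hΦG : ∀ x, Φ (G x) = x) :
    IsShearTangent (conjDilationField Φ G) := by
  refine .of_approx fun K hK δ hδ => ?_
  obtain ⟨C, hC, hC'⟩ := exists_conjDilation_taylor_bound hΦ hG hΦG hK
  obtain ⟨r, hr0, hr⟩ : ∃ r : ℝ, 0 < r ∧ r ≤ min (1 / 2) δ / (C + 1) :=
    ⟨_, by positivity, le_rfl⟩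
  rw [le_div_iff₀ (by positivity)] at hr
  have hr1 : r < 1 := by nlinarith [min_le_left (1 / 2) δ]
  have hr' : (r : ℂ) ≠ 0 := by exact_mod_cast hr0.ne'
  refine ⟨fun x => (r : ℂ)⁻¹ • (Φ (Complex.exp r • G x) - x), ?_, fun x hx => ?_⟩
  · have := (isShearField_of_differentiable hn
      (W := fun x => (r : ℂ)⁻¹ • (Φ (Complex.exp r • G x) - x)) (by fun_prop)).2 1
    rwa [one_smul] at this
  · calc _ = ‖(r : ℂ)⁻¹ • (Φ (Complex.exp r • G x) -
            (x + (r : ℂ) • conjDilationField Φ G x))‖ := by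
          congr 1
          rw [← sub_sub, smul_sub _ _ ((r : ℂ) • _), inv_smul_smul₀ hr']
      _ ≤ r⁻¹ * (C * r ^ 2) := by
          rw [norm_smul, norm_inv, Complex.norm_real, Real.norm_of_nonneg hr0.le]
          gcongr
          exact hC' x hx r hr0 hr1
      _ = C * r := by field_simp
      _ ≤ δ := by nlinarith [min_le_right (1 / 2) δ]

/-- Error propagation for iterates of a perturbation of a dilation. -/
lemma norm_iterate_sub_exp_smul_le {T : CSpace n → CSpace n} {h κ R : ℝ} (hh : 0 ≤ h)
    (hκ : 0 ≤ κ) (hT : ∀ y, ‖y‖ ≤ R → ‖T y - Complex.exp h • y‖ ≤ κ * h) {y : CSpace n} {N : ℕ}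
    (hR : Real.exp (N * h) * ‖y‖ + κ * (N * h) * Real.exp (N * h) ≤ R) :
    ∀ k ≤ N, ‖T^[k] y - Complex.exp ((k * h : ℝ) : ℂ) • y‖ ≤ κ * (k * h) * Real.exp (k * h) := by
  intro k
  induction k with
  | zero => simp
  | succ k ih =>
    intro hk
    have ih := ih (by omega)
    have hkN : (k : ℝ) * h ≤ N * h := by
      gcongr
      exact_mod_cast (by omega : k ≤ N)
    have hball : ‖T^[k] y‖ ≤ R := by
      have h1 : ‖T^[k] y‖ ≤ ‖T^[k] y - Complex.exp ((k * h : ℝ) : ℂ) • y‖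
          + ‖Complex.exp ((k * h : ℝ) : ℂ) • y‖ := by
        simpa using norm_add_le (T^[k] y - Complex.exp ((k * h : ℝ) : ℂ) • y)
          (Complex.exp ((k * h : ℝ) : ℂ) • y)
      rw [norm_smul, Complex.norm_exp_ofReal] at h1
      have h2 : Real.exp (k * h) * ‖y‖ ≤ Real.exp (N * h) * ‖y‖ := by gcongr
      have h3 : κ * (k * h) * Real.exp (k * h) ≤ κ * (N * h) * Real.exp (N * h) := by gcongr
      linarith
    rw [Function.iterate_succ_apply']
    have hexp : Complex.exp (((k + 1 : ℕ) * h : ℝ) : ℂ)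
        = Complex.exp h * Complex.exp ((k * h : ℝ) : ℂ) := by
      rw [← Complex.exp_add]; congr 1; push_cast; ring
    have hexpR : Real.exp ((k + 1 : ℕ) * h) = Real.exp h * Real.exp (k * h) := by
      rw [← Real.exp_add]; congr 1; push_cast; ring
    calc _ = ‖(T (T^[k] y) - Complex.exp h • T^[k] y)
            + Complex.exp h • (T^[k] y - Complex.exp ((k * h : ℝ) : ℂ) • y)‖ := by
          rw [hexp]; congr 1; module
      _ ≤ κ * h + Real.exp h * (κ * (k * h) * Real.exp (k * h)) := by
          refine (norm_add_le _ _).trans ?_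
          rw [norm_smul, Complex.norm_exp_ofReal]
          gcongr
          exact hT _ hball
      _ ≤ κ * h * (Real.exp h * Real.exp (k * h))
            + Real.exp h * (κ * (k * h) * Real.exp (k * h)) := by
          have : κ * h ≤ κ * h * (Real.exp h * Real.exp (k * h)) := by
            refine le_mul_of_one_le_right (by positivity) ?_
            rw [← Real.exp_add]
            exact Real.one_le_exp (by positivity)
          linarith
      _ = _ := by rw [hexpR]; push_cast; ring

/-- The flow `x ↦ Φ (eʳ Φ⁻¹(x))` is a limit of compositions of shears. -/
lemma exists_isShearComposition_conjDilation (hn : 2 ≤ n) (hΦ : Differentiable ℂ Φ)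
    (hG : Differentiable ℂ G) (hGΦ : ∀ x, G (Φ x) = x) (hΦG : ∀ x, Φ (G x) = x)
    {r : ℝ} (hr : 0 < r) {K : Set (CSpace n)} (hK : IsCompact K) {ε : ℝ} (hε : 0 < ε) :
    ∃ ψ, IsShearComposition ψ ∧ ∀ x ∈ K, ‖ψ x - Φ (Complex.exp r • G x)‖ < ε := by
  obtain ⟨R₀, hR₀⟩ := hK.exists_bound_of_continuousOn hG.continuous.continuousOn
  set R := Real.exp r * |R₀| + 1
  have hRpos : 0 < R := by positivity
  have hB : IsCompact (Metric.closedBall (0 : CSpace n) R) := isCompact_closedBall _ _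
  have hX := hB.image hΦ.continuous
  obtain ⟨L, hL, hLip⟩ := exists_lipschitz_near hG
    ((isCompact_closedBall (0 : CSpace n) (Real.exp r * R)).image hΦ.continuous)
  obtain ⟨ρ, hρ, hΦρ⟩ := Metric.uniformContinuousOn_iff.1
    (hB.uniformContinuousOn_of_continuous hΦ.continuous.continuousOn) ε hε
  obtain ⟨C, hC, hTaylor⟩ := exists_conjDilation_taylor_bound hΦ hG hΦG hX
  obtain ⟨κ, hκ, hκr⟩ : ∃ κ : ℝ, 0 < κ ∧ κ * r * Real.exp r < min ρ 1 := by
    refine ⟨min ρ 1 / (r * Real.exp r + 1), by positivity, ?_⟩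
    have h1 : 0 < r * Real.exp r := by positivity
    rw [mul_assoc, div_mul_eq_mul_div, div_lt_iff₀ (by positivity)]
    gcongr
    linarith
  set δ := κ / (2 * (L + 1))
  have hδ : 0 < δ := by positivity
  have hδκ : L * (2 * δ) ≤ κ := by
    have : 2 * δ = κ / (L + 1) := by simp only [δ]; field_simp
    rw [this, mul_div_assoc', div_le_iff₀ (by positivity)]
    nlinarith
  have hlim : Tendsto (fun N : ℕ => r / (N : ℝ)) atTop (𝓝[>] 0) := by
    refine tendsto_nhdsWithin_iff.2 ⟨tendsto_const_div_atTop_nhds_zero_nat r, ?_⟩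
    filter_upwards [eventually_gt_atTop 0] with N hN
    have : (0 : ℝ) < N := by exact_mod_cast hN
    exact div_pos hr this
  have hsmall : 0 < min 1 (min r (min (δ / (C + 1)) (1 / (2 * δ)))) := by positivity
  obtain ⟨N, ⟨⟨S, hS, hSV⟩, hh⟩, hN⟩ := ((hlim.eventually
    (((isShearTangent_conjDilationField hn hΦ hG hΦG) _ hX δ hδ).and
      (Ioo_mem_nhdsGT hsmall))).and (eventually_gt_atTop 0)).exists
  set h := r / (N : ℝ)
  have h0 : 0 < h := hh.1
  obtain ⟨h1, hh⟩ := lt_min_iff.1 hh.2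
  obtain ⟨h2, hh⟩ := lt_min_iff.1 hh
  obtain ⟨h3, h4⟩ := lt_min_iff.1 hh
  rw [lt_div_iff₀ (by positivity)] at h3 h4
  have hNh : (N : ℝ) * h = r := by
    have : (N : ℝ) ≠ 0 := by exact_mod_cast hN.ne'
    simp only [h]; field_simp
  have hstep : ∀ y, ‖y‖ ≤ R → ‖G (S (Φ y)) - Complex.exp h • y‖ ≤ κ * h := by
    intro y hy
    have hy' : Φ y ∈ Φ '' Metric.closedBall 0 R := ⟨y, by simpa using hy, rfl⟩
    have e1 := hSV _ hy'
    have e2 := hTaylor _ hy' h h0 h1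
    rw [hGΦ] at e2
    have e3 : ‖S (Φ y) - Φ (Complex.exp h • y)‖ ≤ 2 * δ * h := by
      refine (norm_sub_le_norm_sub_add_norm_sub _
        (Φ y + (h : ℂ) • conjDilationField Φ G (Φ y)) _).trans ?_
      rw [norm_sub_rev _ (Φ (Complex.exp h • y))]
      nlinarith
    have hmem : Φ (Complex.exp h • y) ∈ Φ '' Metric.closedBall 0 (Real.exp r * R) := by
      refine ⟨_, ?_, rfl⟩
      rw [mem_closedBall_zero_iff, norm_smul, Complex.norm_exp_ofReal]
      gcongr
    have e4 := hLip _ hmem (S (Φ y)) (by linarith)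
    rw [hGΦ] at e4
    calc _ ≤ L * ‖S (Φ y) - Φ (Complex.exp h • y)‖ := e4
      _ ≤ L * (2 * δ * h) := by gcongr
      _ = L * (2 * δ) * h := by ring
      _ ≤ κ * h := by gcongr
  have hκ1 : κ * r * Real.exp r < 1 := hκr.trans_le (min_le_right _ _)
  refine ⟨S^[N], hS.iterate hn N, fun x hx => ?_⟩
  have hGx : ‖G x‖ ≤ |R₀| := (hR₀ x hx).trans (le_abs_self _)
  have hGxR : Real.exp r * ‖G x‖ ≤ Real.exp r * |R₀| := by gcongr
  have hiter := norm_iterate_sub_exp_smul_le (T := fun y => G (S (Φ y))) h0.le hκ.le hstep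
    (y := G x) (N := N) (by rw [hNh]; linarith) N le_rfl
  rw [hNh] at hiter
  have hconj : S^[N] x = Φ ((fun y => G (S (Φ y)))^[N] (G x)) := by
    have : Function.Semiconj Φ (fun y => G (S (Φ y))) S := fun y => hΦG _
    rw [(this.iterate_right N).eq, hΦG]
  set q := (fun y => G (S (Φ y)))^[N] (G x)
  have hexpG : ‖Complex.exp r • G x‖ ≤ Real.exp r * |R₀| := by
    rwa [norm_smul, Complex.norm_exp_ofReal]
  rw [hconj, ← dist_eq_norm]
  refine hΦρ _ ?_ _ ?_ ?_
  · rw [mem_closedBall_zero_iff]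
    have := norm_add_le (q - Complex.exp r • G x) (Complex.exp r • G x)
    rw [sub_add_cancel] at this
    linarith
  · rw [mem_closedBall_zero_iff]
    linarith
  · rw [dist_eq_norm]
    exact hiter.trans_lt (hκr.trans_le (min_le_left _ _))

lemma exists_isShearComposition_of_map_zero (hn : 2 ≤ n) (hΦ : Differentiable ℂ Φ)
    (hG : Differentiable ℂ G) (hGΦ : ∀ x, G (Φ x) = x) (hΦG : ∀ x, Φ (G x) = x)
    (hΦ0 : Φ 0 = 0) {K : Set (CSpace n)} (hK : IsCompact K) {ε : ℝ} (hε : 0 < ε) :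
    ∃ ψ, IsShearComposition ψ ∧ ∀ x ∈ K, ‖ψ x - Φ x‖ < ε := by
  have hG0 : G 0 = 0 := by rw [← hΦ0, hGΦ, hΦ0]
  have hdΦ : HasFDerivAt Φ (fderiv ℂ Φ 0) (G 0) := by rw [hG0]; exact (hΦ 0).hasFDerivAt
  have hdG : HasFDerivAt G (fderiv ℂ G 0) (Φ 0) := by rw [hΦ0]; exact (hG 0).hasFDerivAt
  have hGΦ' : (fderiv ℂ G 0).comp (fderiv ℂ Φ 0) = ContinuousLinearMap.id ℂ _ := by
    refine (hdG.comp 0 (hΦ 0).hasFDerivAt).unique ?_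
    rw [show G ∘ Φ = id from funext hGΦ]
    exact hasFDerivAt_id 0
  have hΦG' : (fderiv ℂ Φ 0).comp (fderiv ℂ G 0) = ContinuousLinearMap.id ℂ _ := by
    refine (hdΦ.comp 0 (hG 0).hasFDerivAt).unique ?_
    rw [show Φ ∘ G = id from funext hΦG]
    exact hasFDerivAt_id 0
  let A : CSpace n ≃ₗ[ℂ] CSpace n :=
    LinearEquiv.ofLinearMap (fderiv ℂ Φ 0).toLinearMap (fderiv ℂ G 0).toLinearMap
      (by ext1 x; exact DFunLike.congr_fun hΦG' x) (by ext1 x; exact DFunLike.congr_fun hGΦ' x)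
  have hDA : ∀ x, fderiv ℂ G 0 (A x) = x := fun x => DFunLike.congr_fun hGΦ' x
  have hAc : Continuous A := (fderiv ℂ Φ 0).continuous
  obtain ⟨M, hM⟩ := hK.exists_bound_of_continuousOn (f := A) hAc.continuousOn
  have hK1 : IsCompact (Metric.cthickening 1 K) := hK.cthickening
  obtain ⟨ρ, hρ, hΦρ⟩ := Metric.uniformContinuousOn_iff.1
    (hK1.uniformContinuousOn_of_continuous hΦ.continuous.continuousOn) (ε / 2) (by positivity)
  have hη : 0 < min ρ 1 / (2 * (|M| + 1)) := by positivity
  obtain ⟨s, hs, hsG⟩ := Metric.eventually_nhds_iff.1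
    ((hG 0).hasFDerivAt.isLittleO.def hη)
  set r := |M| / s + 1
  have hr : 0 < r := by positivity
  have hexp : (0 : ℝ) < Real.exp r := Real.exp_pos r
  have hMr : |M| < Real.exp r * s := by
    have h1 := Real.add_one_le_exp r
    have h2 : |M| / s < Real.exp r := by simp only [r] at h1 ⊢; linarith
    rwa [div_lt_iff₀ hs] at h2
  have hne : Complex.exp r ≠ 0 := Complex.exp_ne_zero _
  let B : CSpace n ≃ₗ[ℂ] CSpace n :=
    A.trans (LinearEquiv.smulOfNeZero ℂ (CSpace n) (Complex.exp r)⁻¹ (inv_ne_zero hne))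
  have hB : ∀ x, B x = (Complex.exp r)⁻¹ • A x := fun x => rfl
  have hBc : Continuous B := hAc.const_smul (Complex.exp r)⁻¹
  obtain ⟨ψ, hψ, hψΦ⟩ := exists_isShearComposition_conjDilation hn hΦ hG hGΦ hΦG hr
    (hK.image hBc) (half_pos hε)
  refine ⟨ψ ∘ fun x => B x, hψ.comp (isShearComposition_linear hn B), fun x hx => ?_⟩
  have e1 := hψΦ (B x) ⟨x, hx, rfl⟩
  have hAx : ‖A x‖ ≤ |M| := (hM x hx).trans (le_abs_self M)
  have hnB : ‖B x‖ = (Real.exp r)⁻¹ * ‖A x‖ := by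
    rw [hB, norm_smul, norm_inv, Complex.norm_exp_ofReal]
  have e2 := hsG (y := B x) (by
    rw [dist_zero_right, hnB, inv_mul_lt_iff₀ hexp]
    exact hAx.trans_lt hMr)
  rw [hG0, sub_zero, sub_zero] at e2
  have e3 : ‖Complex.exp r • G (B x) - x‖ < min ρ 1 := by
    have e : Complex.exp r • G (B x) - x = Complex.exp r • (G (B x) - fderiv ℂ G 0 (B x)) := by
      rw [smul_sub, hB, map_smul, smul_inv_smul₀ hne, hDA]
    rw [e, norm_smul, Complex.norm_exp_ofReal]
    calc _ ≤ Real.exp r * (min ρ 1 / (2 * (|M| + 1)) * ‖B x‖) := by gcongr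
      _ = min ρ 1 / (2 * (|M| + 1)) * ‖A x‖ := by rw [hnB]; field_simp
      _ ≤ min ρ 1 / (2 * (|M| + 1)) * |M| := by gcongr
      _ < min ρ 1 := by
        rw [div_mul_eq_mul_div, div_lt_iff₀ (by positivity)]
        have : 0 < min ρ 1 := by positivity
        nlinarith [abs_nonneg M]
  have e4 := hΦρ (Complex.exp r • G (B x))
    (Metric.mem_cthickening_of_dist_le _ x _ _ hx
      (by rw [dist_eq_norm]; exact e3.le.trans (min_le_right _ _)))
    x (Metric.self_subset_cthickening K hx)
    (by rw [dist_eq_norm]; exact e3.trans_le (min_le_left _ _))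
  rw [dist_eq_norm] at e4
  calc _ ≤ _ := norm_sub_le_norm_sub_add_norm_sub _ (Φ (Complex.exp r • G (B x))) _
    _ < ε / 2 + ε / 2 := add_lt_add e1 e4
    _ = ε := add_halves ε

end Flows

/-- Andersén–Lempert: the group generated by shears is dense in `Aut(ℂⁿ)` for `n ≥ 2`. -/
theorem shears_dense_in_automorphisms (n : ℕ) (hn : 2 ≤ n)
    (Φ : EuclideanSpace ℂ (Fin n) → EuclideanSpace ℂ (Fin n))
    (hΦ : IsHolomorphicAutomorphism Φ)
    (K : Set (EuclideanSpace ℂ (Fin n))) (hK : IsCompact K)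
    (ε : ℝ) (hε : 0 < ε) :
    ∃ ψ : EuclideanSpace ℂ (Fin n) → EuclideanSpace ℂ (Fin n),
      IsShearComposition ψ ∧ ∀ z ∈ K, ‖ψ z - Φ z‖ < ε := by
  obtain ⟨hΦd, G, hGd, hGΦ, hΦG⟩ := hΦ
  obtain ⟨ψ, hψ, hψΦ⟩ := exists_isShearComposition_of_map_zero hn (Φ := fun z => Φ z - Φ 0)
    (G := fun w => G (w + Φ 0)) (by fun_prop) (by fun_prop) (fun x => by simpa using hGΦ x)
    (fun x => by simp [hΦG]) (sub_self _) hK hε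
  refine ⟨(fun x => x + Φ 0) ∘ ψ, (isShearComposition_add_const hn (Φ 0)).comp hψ,
    fun z hz => ?_⟩
  have e : ψ z + Φ 0 - Φ z = ψ z - (Φ z - Φ 0) := by abel
  simpa only [Function.comp_apply, e] using hψΦ z hz
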